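/- arXiv:1102.5574 — 2 statements merged into one kernel-verified Lean document; each statement's English description precedes it below -/
import Mathlib

section
/- Let p_1, ..., p_n be distinct primes, let α_1 ≥ α_2 ≥ ... ≥ α_u > α_{u+1} = ... = α_n ≥ 2 (with u = 0 if all α_i are equal), and let N = p_1^{α_1}···p_n^{α_n}. A set D of positive divisors of N is a maximal N-set of minimum size (i.e. |D| = α_n · ∏_{i=1}^{n-1} (α_i + 1)) if and only if D = R({p_v}, N) for some v with u+1 ≤ v ≤ n; that is, R({p_{u+1}}, N), ..., R({p_n}, N) are exactly the maximal N-sets of minimum size. -/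
open Finset

/-- `D` is an `N`-set: a set of positive divisors of `N`, no two elements of which
are coprime. -/
def IsNSet (N : ℕ) (D : Finset ℕ) : Prop :=
  (∀ d ∈ D, d ∣ N) ∧ (∀ d ∈ D, ∀ e ∈ D, Nat.gcd d e ≠ 1)

/-- An `N`-set `D` is maximal if no further divisor of `N` can be added while keeping
the property that no two elements are coprime. -/
def IsMaxNSet (N : ℕ) (D : Finset ℕ) : Prop :=
  IsNSet N D ∧ ∀ l, l ∣ N → l ∉ D → ∃ d ∈ D, Nat.gcd l d = 1

/-- `dSet D` is the set of divisible minimal elements of `D`: those elements of `D`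
not divisible by any other element of `D`. -/
def dSet (D : Finset ℕ) : Finset ℕ :=
  D.filter fun d => ∀ e ∈ D, e ∣ d → e = d

/-- `RSet T N` is `R(T, N)`: the set of positive divisors of `N` divisible by at least
one element of `T`. -/
def RSet (T : Finset ℕ) (N : ℕ) : Finset ℕ :=
  N.divisors.filter fun l => ∃ t ∈ T, t ∣ l

section ExponentVectors

variable {ι : Type*} [Fintype ι] {p α : ι → ℕ}

/-- The number with exponent vector `x` with respect to the primes `p i`. -/
def ofExponents (p α : ι → ℕ) (x : ∀ i, ZMod (α i + 1)) : ℕ :=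
  ∏ i, p i ^ (x i).val

lemma factorization_prod_prime_pow (hp : ∀ i, (p i).Prime) (hinj : Function.Injective p)
    (e : ι → ℕ) (j : ι) : (∏ i, p i ^ e i).factorization (p j) = e j := by
  rw [Nat.factorization_prod (fun i _ => pow_ne_zero _ (hp i).ne_zero), Finsupp.finsetSum_apply,
    Finset.sum_eq_single j]
  · simp [(hp j).factorization]
  · intro i _ hij
    simp [(hp i).factorization, hinj.ne hij]
  · simp

lemma eq_of_prime_dvd_prod_prime_pow (hp : ∀ i, (p i).Prime) {e : ι → ℕ} {q : ℕ}
    (hq : q.Prime) (h : q ∣ ∏ i, p i ^ e i) : ∃ i, q = p i := by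
  obtain ⟨i, -, hi⟩ := (hq.prime.dvd_finsetProd_iff _).1 h
  exact ⟨i, (Nat.prime_dvd_prime_iff_eq hq (hp i)).1 (hq.dvd_of_dvd_pow hi)⟩

lemma ofExponents_injective (hp : ∀ i, (p i).Prime) (hinj : Function.Injective p) :
    Function.Injective (ofExponents p α) := by
  intro x y h
  funext j
  apply ZMod.val_injective
  rw [← factorization_prod_prime_pow hp hinj (fun i => (x i).val) j,
    ← factorization_prod_prime_pow hp hinj (fun i => (y i).val) j]
  exact congrArg (fun m => Nat.factorization m (p j)) h

lemma ofExponents_dvd (x : ∀ i, ZMod (α i + 1)) : ofExponents p α x ∣ ∏ i, p i ^ α i :=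
  Finset.prod_dvd_prod_of_dvd _ _ fun i _ =>
    pow_dvd_pow _ (Nat.lt_succ_iff.1 (ZMod.val_lt (x i)))

lemma exists_ofExponents_eq (hp : ∀ i, (p i).Prime) (hinj : Function.Injective p)
    {l : ℕ} (hl : l ∣ ∏ i, p i ^ α i) : ∃ x, ofExponents p α x = l := by
  have hN : ∏ i, p i ^ α i ≠ 0 := Finset.prod_ne_zero_iff.2 fun i _ => pow_ne_zero _ (hp i).ne_zero
  have hl0 : l ≠ 0 := ne_zero_of_dvd_ne_zero hN hl
  have hle (i : ι) : l.factorization (p i) ≤ α i := by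
    rw [← factorization_prod_prime_pow hp hinj α i]
    exact (Nat.factorization_le_iff_dvd hl0 hN).2 hl (p i)
  refine ⟨fun i => (l.factorization (p i) : ZMod (α i + 1)), ?_⟩
  have hval : ofExponents p α (fun i => (l.factorization (p i) : ZMod (α i + 1))) =
      ∏ i, p i ^ l.factorization (p i) :=
    Finset.prod_congr rfl fun i _ => by
      rw [ZMod.val_natCast_of_lt (Nat.lt_succ_iff.2 (hle i))]
  rw [hval]
  refine Nat.eq_of_factorization_eq
    (Finset.prod_ne_zero_iff.2 fun i _ => pow_ne_zero _ (hp i).ne_zero) hl0 fun q => ?_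
  by_cases hq : ∃ i, q = p i
  · obtain ⟨i, rfl⟩ := hq
    exact factorization_prod_prime_pow hp hinj _ i
  · by_cases hqp : q.Prime
    · rw [Nat.factorization_eq_zero_of_not_dvd, Nat.factorization_eq_zero_of_not_dvd]
      · exact fun h => hq (eq_of_prime_dvd_prod_prime_pow hp hqp (h.trans hl))
      · exact fun h => hq (eq_of_prime_dvd_prod_prime_pow hp hqp h)
    · simp [Nat.factorization_eq_zero_of_not_prime _ hqp]

lemma prime_dvd_ofExponents_iff (hp : ∀ i, (p i).Prime) (hinj : Function.Injective p)
    (x : ∀ i, ZMod (α i + 1)) (j : ι) : p j ∣ ofExponents p α x ↔ x j ≠ 0 := by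
  have h0 : ofExponents p α x ≠ 0 :=
    Finset.prod_ne_zero_iff.2 fun i _ => pow_ne_zero _ (hp i).ne_zero
  rw [(hp j).dvd_iff_one_le_factorization h0, ofExponents,
    factorization_prod_prime_pow hp hinj (fun i => (x i).val) j, Nat.one_le_iff_ne_zero, Ne,
    ZMod.val_eq_zero]

lemma gcd_ne_one_iff_exists_prime_dvd (hp : ∀ i, (p i).Prime) {d e : ℕ}
    (hd : d ∣ ∏ i, p i ^ α i) : Nat.gcd d e ≠ 1 ↔ ∃ i, p i ∣ d ∧ p i ∣ e := by
  rw [Nat.ne_one_iff_exists_prime_dvd]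
  constructor
  · rintro ⟨q, hq, h⟩
    obtain ⟨hqd, hqe⟩ := Nat.dvd_gcd_iff.1 h
    obtain ⟨i, rfl⟩ := eq_of_prime_dvd_prod_prime_pow hp hq (hqd.trans hd)
    exact ⟨i, hqd, hqe⟩
  · rintro ⟨i, h⟩
    exact ⟨p i, hp i, Nat.dvd_gcd h.1 h.2⟩

/-- Two divisors outside a maximal `N`-set are both prime to a common prime factor. -/
lemma IsMaxNSet.exists_not_dvd_of_notMem (hp : ∀ i, (p i).Prime) {D : Finset ℕ}
    (hD : IsMaxNSet (∏ i, p i ^ α i) D) {l m : ℕ} (hl : l ∣ ∏ i, p i ^ α i)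
    (hm : m ∣ ∏ i, p i ^ α i) (hlD : l ∉ D) (hmD : m ∉ D) : ∃ i, ¬ p i ∣ l ∧ ¬ p i ∣ m := by
  obtain ⟨d, hd, hld⟩ := hD.2 l hl hlD
  obtain ⟨e, he, hme⟩ := hD.2 m hm hmD
  obtain ⟨i, hid, hie⟩ := (gcd_ne_one_iff_exists_prime_dvd hp (hD.1.1 d hd)).1 (hD.1.2 d hd e he)
  exact ⟨i, fun h => (hp i).not_dvd_one (hld ▸ Nat.dvd_gcd h hid),
    fun h => (hp i).not_dvd_one (hme ▸ Nat.dvd_gcd h hie)⟩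

variable [DecidableEq ι]

lemma card_filter_eq_card_exponents (hp : ∀ i, (p i).Prime) (hinj : Function.Injective p)
    (P : ℕ → Prop) [DecidablePred P] :
    ((∏ i, p i ^ α i).divisors.filter P).card =
      (Finset.univ.filter fun x => P (ofExponents p α x)).card := by
  have hN : ∏ i, p i ^ α i ≠ 0 := Finset.prod_ne_zero_iff.2 fun i _ => pow_ne_zero _ (hp i).ne_zero
  rw [← Finset.card_image_of_injective _ (ofExponents_injective (α := α) hp hinj)]
  congr 1
  ext l
  simp only [Finset.mem_filter, Nat.mem_divisors, Finset.mem_image, Finset.mem_univ, true_and]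
  constructor
  · rintro ⟨⟨hl, -⟩, h⟩
    obtain ⟨x, rfl⟩ := exists_ofExponents_eq hp hinj hl
    exact ⟨x, h, rfl⟩
  · rintro ⟨x, h, rfl⟩
    exact ⟨⟨ofExponents_dvd x, hN⟩, h⟩

lemma card_RSet_singleton (hp : ∀ i, (p i).Prime) (hinj : Function.Injective p) (v : ι) :
    (RSet {p v} (∏ i, p i ^ α i)).card = α v * ∏ i ∈ Finset.univ.erase v, (α i + 1) := by
  have hset : (Finset.univ.filter fun x : ∀ i, ZMod (α i + 1) =>
      ∃ t ∈ ({p v} : Finset ℕ), t ∣ ofExponents p α x) =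
      Fintype.piFinset fun i => if i = v then Finset.univ.erase 0 else Finset.univ := by
    ext x
    simp only [Finset.mem_filter, Finset.mem_univ, true_and, Finset.mem_singleton,
      exists_eq_left, prime_dvd_ofExponents_iff hp hinj, Fintype.mem_piFinset]
    constructor
    · intro h i
      by_cases hi : i = v
      · subst hi; simpa using h
      · simp [hi]
    · intro h
      simpa using h v
  rw [RSet, card_filter_eq_card_exponents hp hinj, hset, Fintype.card_piFinset,
    ← Finset.mul_prod_erase _ _ (Finset.mem_univ v)]
  congr 1
  · simp [ZMod.card]
  · refine Finset.prod_congr rfl fun i hi => ?_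
    simp [Finset.ne_of_mem_erase hi, ZMod.card]

lemma isMaxNSet_RSet_singleton {N q : ℕ} (hN : N ≠ 0) (hq : q.Prime) (hqN : q ∣ N) :
    IsMaxNSet N (RSet {q} N) := by
  have hmem (l : ℕ) : l ∈ RSet {q} N ↔ l ∣ N ∧ q ∣ l := by simp [RSet, hN]
  refine ⟨⟨fun d hd => ((hmem d).1 hd).1, fun d hd e he h => ?_⟩, fun l hl hlD => ?_⟩
  · exact hq.not_dvd_one (h ▸ Nat.dvd_gcd ((hmem d).1 hd).2 ((hmem e).1 he).2)
  · refine ⟨q, (hmem q).2 ⟨hqN, dvd_rfl⟩, ?_⟩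
    exact ((Nat.Prime.coprime_iff_not_dvd hq).2 fun h => hlD ((hmem l).2 ⟨hl, h⟩)).symm

lemma eq_of_natCast_eq_of_le {a k : ℕ} (h : a ≤ k) {s t : ℕ} (hs : s ≤ a) (ht : t ≤ a)
    (hst : (s : ZMod (k + 1)) = t) : s = t := by
  have := congrArg ZMod.val hst
  rwa [ZMod.val_natCast_of_lt (by omega), ZMod.val_natCast_of_lt (by omega)] at this

/-- If the complement of a maximal `N`-set has the largest possible size, then every diagonal
segment of exponent vectors meets this complement. -/
lemma IsMaxNSet.exists_add_notMem (hp : ∀ i, (p i).Prime) (hinj : Function.Injective p)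
    {D : Finset ℕ} (hD : IsMaxNSet (∏ i, p i ^ α i) D) {a : ℕ} (ha : ∀ i, a ≤ α i)
    (hcard : (a + 1) * (Finset.univ.filter fun x => ofExponents p α x ∉ D).card =
      ∏ i, (α i + 1)) (x : ∀ i, ZMod (α i + 1)) :
    ∃ t ≤ a, ofExponents p α (fun i => x i + (t : ZMod (α i + 1))) ∉ D := by
  let A (x : ∀ i, ZMod (α i + 1)) : Finset ℕ := (Finset.range (a + 1)).filter fun t =>
    ofExponents p α (fun i => x i + (t : ZMod (α i + 1))) ∉ D
  have hle (y) : (A y).card ≤ 1 := by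
    rw [Finset.card_le_one]
    intro s hs t ht
    simp only [A, Finset.mem_filter, Finset.mem_range] at hs ht
    obtain ⟨i, h1, h2⟩ := hD.exists_not_dvd_of_notMem hp (ofExponents_dvd _) (ofExponents_dvd _)
      hs.2 ht.2
    rw [prime_dvd_ofExponents_iff hp hinj, not_not] at h1 h2
    exact eq_of_natCast_eq_of_le (ha i) (by omega) (by omega)
      (add_left_cancel (h1.trans h2.symm))
  have hsum : ∑ y, (A y).card = ∑ y : (∀ i, ZMod (α i + 1)), 1 := by
    have hshift (t : ℕ) : (∑ y : (∀ i, ZMod (α i + 1)),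
        if ofExponents p α (fun i => y i + (t : ZMod (α i + 1))) ∉ D then 1 else 0) =
        (Finset.univ.filter fun x => ofExponents p α x ∉ D).card := by
      rw [Finset.card_filter]
      exact Equiv.sum_comp (Equiv.addRight fun i => (t : ZMod (α i + 1)))
        (fun y => if ofExponents p α y ∉ D then 1 else 0)
    simp only [A, Finset.card_filter]
    rw [Finset.sum_comm, Finset.sum_congr rfl fun t _ => hshift t]
    simpa [ZMod.card] using hcard
  have hx := (Finset.sum_eq_sum_iff_of_le fun y _ => hle y).1 hsum x (Finset.mem_univ x)
  obtain ⟨t, ht⟩ := Finset.card_pos.1 (hx ▸ Nat.one_pos)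
  simp only [A, Finset.mem_filter, Finset.mem_range] at ht
  exact ⟨t, by omega, ht.2⟩

/-- A maximal `N`-set of extremal size consists of the multiples of one of the primes. -/
lemma IsMaxNSet.exists_eq_RSet (hp : ∀ i, (p i).Prime) (hinj : Function.Injective p)
    {D : Finset ℕ} (hD : IsMaxNSet (∏ i, p i ^ α i) D) (hne : D.Nonempty) {a : ℕ} (ha2 : 2 ≤ a)
    (ha : ∀ i, a ≤ α i)
    (hcard : (a + 1) * (Finset.univ.filter fun x => ofExponents p α x ∉ D).card =
      ∏ i, (α i + 1)) : ∃ v, D = RSet {p v} (∏ i, p i ^ α i) := by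
  have hN : ∏ i, p i ^ α i ≠ 0 := Finset.prod_ne_zero_iff.2 fun i _ => pow_ne_zero _ (hp i).ne_zero
  have hcolor (c : ι → ℕ) (hc : ∀ i, c i ≤ 2) : ∃ t, ∃ e ∈ D, ∀ i, p i ∣ e → c i = t := by
    obtain ⟨t, hta, ht⟩ := hD.exists_add_notMem hp hinj ha hcard fun i => -(c i : ZMod (α i + 1))
    obtain ⟨e, he, hle⟩ := hD.2 _ (ofExponents_dvd _) ht
    refine ⟨t, e, he, fun i hi => ?_⟩
    by_contra hct
    refine (hp i).not_dvd_one (hle ▸ Nat.dvd_gcd ?_ hi)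
    rw [prime_dvd_ofExponents_iff hp hinj]
    intro h0
    refine hct (eq_of_natCast_eq_of_le (ha i) ((hc i).trans ha2) hta ?_)
    exact neg_add_eq_zero.1 h0
  let supp (d : ℕ) : Finset ι := Finset.univ.filter fun i => p i ∣ d
  have hsupp (d i) : i ∈ supp d ↔ p i ∣ d := by simp [supp]
  obtain ⟨d, hd, hmin⟩ := Finset.exists_min_image D (fun d => (supp d).card) hne
  have hmeet (e) (he : e ∈ D) : ∃ i, p i ∣ d ∧ p i ∣ e :=
    (gcd_ne_one_iff_exists_prime_dvd hp (hD.1.1 d hd)).1 (hD.1.2 d hd e he)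
  obtain ⟨v, hv, -⟩ := hmeet d hd
  have hsub (e) (he : e ∈ D) (h : supp e ⊆ supp d) (i) (hi : p i ∣ d) : p i ∣ e := by
    rw [← hsupp, Finset.eq_of_subset_of_card_le h (hmin e he), hsupp]
    exact hi
  have huniq (j) (hj : p j ∣ d) : j = v := by
    by_contra hjv
    obtain ⟨t, e, he, hct⟩ := hcolor
      (fun i => if i = v then 0 else if p i ∣ d then 1 else 2) (fun i => by split_ifs <;> simp)
    obtain ⟨k, hkd, hke⟩ := hmeet e he
    have hk := hct k hke
    have hsub' : supp e ⊆ supp d := by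
      intro i hi
      rw [hsupp] at hi ⊢
      have hi' := hct i hi
      by_contra hid
      have hiv : i ≠ v := fun h => hid (h ▸ hv)
      simp only [hiv, hid, hkd, if_true, if_false] at hk hi'
      split_ifs at hk <;> omega
    have h1 := hct v (hsub e he hsub' v hv)
    have h2 := hct j (hsub e he hsub' j hj)
    simp only [hjv, hj, if_true, if_false] at h1 h2
    omega
  refine ⟨v, ?_⟩
  ext l
  simp only [RSet, Finset.mem_filter, Nat.mem_divisors, Finset.mem_singleton, exists_eq_left]
  constructor
  · intro hl
    obtain ⟨i, hid, hil⟩ := hmeet l hl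
    exact ⟨⟨hD.1.1 l hl, hN⟩, huniq i hid ▸ hil⟩
  · rintro ⟨⟨hl, -⟩, hvl⟩
    by_contra hlD
    obtain ⟨e, he, hle⟩ := hD.2 l hl hlD
    obtain ⟨i, hid, hie⟩ := hmeet e he
    exact (hp v).not_dvd_one (hle ▸ Nat.dvd_gcd hvl (huniq i hid ▸ hie))

lemma eq_of_mul_prod_erase_eq {v w : ι}
    (h : α v * ∏ i ∈ Finset.univ.erase v, (α i + 1) =
      α w * ∏ i ∈ Finset.univ.erase w, (α i + 1)) : α v = α w := by
  have hv := Finset.mul_prod_erase Finset.univ (fun i => α i + 1) (Finset.mem_univ v)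
  have hw := Finset.mul_prod_erase Finset.univ (fun i => α i + 1) (Finset.mem_univ w)
  have hpos : 0 < ∏ i ∈ Finset.univ.erase v, (α i + 1) := Finset.prod_pos fun i _ => by omega
  set P := ∏ i ∈ Finset.univ.erase v, (α i + 1)
  set Q := ∏ i ∈ Finset.univ.erase w, (α i + 1)
  have hPQ : P = Q := by linarith
  rw [← hPQ] at h
  exact Nat.eq_of_mul_eq_mul_right hpos h

lemma mul_prod_erase_eq {v w : ι} (h : α v = α w) :
    α v * ∏ i ∈ Finset.univ.erase v, (α i + 1) =
      α w * ∏ i ∈ Finset.univ.erase w, (α i + 1) := by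
  have hv := Finset.mul_prod_erase Finset.univ (fun i => α i + 1) (Finset.mem_univ v)
  have hw := Finset.mul_prod_erase Finset.univ (fun i => α i + 1) (Finset.mem_univ w)
  rw [← hw, ← h] at hv
  rw [← h, Nat.eq_of_mul_eq_mul_left (Nat.succ_pos _) hv]

end ExponentVectors

/-- **Theorem 4.** With `α₁ ≥ ⋯ ≥ α_u > α_{u+1} = ⋯ = α_n ≥ 2` (0-indexed) and
`N = p₁^{α₁} ⋯ p_n^{α_n}`: a set `D` of positive divisors of `N` is a maximal `N`-set
of minimum size `α_n ∏_{i=1}^{n-1} (α_i + 1)` if and only if `D = R({p_v}, N)` for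
some `u+1 ≤ v ≤ n`. -/
theorem stmt_6 (n u : ℕ) (hu : u < n) (p α : Fin n → ℕ)
    (hp : ∀ i, (p i).Prime) (hinj : Function.Injective p)
    (hanti : ∀ i j : Fin n, i ≤ j → α j ≤ α i)
    (hconst : ∀ i : Fin n, u ≤ (i : ℕ) → α i = α ⟨u, hu⟩)
    (hstrict : ∀ i : Fin n, (i : ℕ) < u → α ⟨u, hu⟩ < α i)
    (h2 : 2 ≤ α ⟨u, hu⟩)
    (N : ℕ) (hN : N = ∏ i, p i ^ α i)
    (D : Finset ℕ) (hDdvd : ∀ d ∈ D, d ∣ N) :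
    (IsMaxNSet N D ∧
        D.card = α ⟨n - 1, by omega⟩ *
          ∏ i ∈ Finset.univ.erase ⟨n - 1, by omega⟩, (α i + 1)) ↔
      ∃ v : Fin n, u ≤ (v : ℕ) ∧ D = RSet {p v} N := by
  subst hN
  have hN0 : ∏ i, p i ^ α i ≠ 0 := Finset.prod_ne_zero_iff.2 fun i _ => pow_ne_zero _ (hp i).ne_zero
  set w : Fin n := ⟨n - 1, by omega⟩ with hw
  have hwu : u ≤ (w : ℕ) := by simp only [hw]; omega
  have hle (i : Fin n) : α w ≤ α i := hanti i w (Fin.le_def.2 (by simp only [hw]; omega))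
  have hw2 : 2 ≤ α w := (hconst w hwu).symm ▸ h2
  have hcardR := card_RSet_singleton (α := α) hp hinj
  constructor
  · rintro ⟨hD, hcard⟩
    have hprod := Finset.mul_prod_erase Finset.univ (fun i => α i + 1) (Finset.mem_univ w)
    have hpos : 0 < ∏ i ∈ Finset.univ.erase w, (α i + 1) := Finset.prod_pos fun i _ => by omega
    have hne : D.Nonempty := Finset.card_pos.1 (hcard ▸ Nat.mul_pos (by omega) hpos)
    have hin := card_filter_eq_card_exponents (α := α) hp hinj (· ∈ D)
    have hDeq : (∏ i, p i ^ α i).divisors.filter (· ∈ D) = D := by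
      ext l
      simp only [Finset.mem_filter, Nat.mem_divisors, and_iff_right_iff_imp]
      exact fun hl => ⟨hDdvd l hl, hN0⟩
    rw [hDeq, hcard] at hin
    have hsplit := Finset.card_filter_add_card_filter_not (s := Finset.univ)
      (fun x => ofExponents p α x ∈ D)
    rw [← hin, Finset.card_univ, Fintype.card_pi] at hsplit
    simp only [ZMod.card] at hsplit
    have hout : (Finset.univ.filter fun x => ofExponents p α x ∉ D).card =
        ∏ i ∈ Finset.univ.erase w, (α i + 1) := by linarith
    obtain ⟨v, hv⟩ := hD.exists_eq_RSet hp hinj hne hw2 hle (by rw [hout, hprod])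
    refine ⟨v, ?_, hv⟩
    have hvw : α v = α w := eq_of_mul_prod_erase_eq (by rw [← hcardR v, ← hv, hcard])
    by_contra! hlt
    have := hstrict v hlt
    rw [hvw, hconst w hwu] at this
    exact lt_irrefl _ this
  · rintro ⟨v, hv, rfl⟩
    have hvw : α v = α w := (hconst v hv).trans (hconst w hwu).symm
    refine ⟨isMaxNSet_RSet_singleton hN0 (hp v) ?_, ?_⟩
    · exact (dvd_pow_self _ (by omega)).trans
        (Finset.dvd_prod_of_mem (fun i => p i ^ α i) (Finset.mem_univ v))
    · rw [hcardR v, mul_prod_erase_eq hvw]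
end

section
/- Let p_1, ..., p_n be distinct primes, N = p_1^{α_1}···p_n^{α_n} with each α_i ≥ 1. If D is a maximal N-set, then D = R(d(D), N); that is, D consists exactly of those divisors of N divisible by at least one divisible minimal element of D. -/
open Finset

/-- Every element of a finite set of positive integers is divisible by a divisible
minimal element. -/
theorem exists_mem_dSet_dvd {D : Finset ℕ} (hpos : ∀ d ∈ D, 0 < d) {d : ℕ} (hd : d ∈ D) :
    ∃ t ∈ dSet D, t ∣ d := by
  induction d using Nat.strong_induction_on with
  | _ d ih =>
    by_cases h : ∀ e ∈ D, e ∣ d → e = d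
    · exact ⟨d, mem_filter.2 ⟨hd, h⟩, dvd_rfl⟩
    · push Not at h
      obtain ⟨e, he, hed, hne⟩ := h
      obtain ⟨t, ht, hte⟩ := ih e ((Nat.le_of_dvd (hpos d hd) hed).lt_of_ne hne) he
      exact ⟨t, ht, hte.trans hed⟩

/-- A maximal `N`-set contains every divisor of `N` that is a multiple of one of its elements. -/
theorem IsMaxNSet.mem_of_dvd {N : ℕ} {D : Finset ℕ} (hD : IsMaxNSet N D) {t l : ℕ}
    (ht : t ∈ D) (htl : t ∣ l) (hl : l ∣ N) : l ∈ D := by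
  by_contra hlD
  obtain ⟨d, hd, hgcd⟩ := hD.2 l hl hlD
  exact hD.1.2 t ht d hd (Nat.Coprime.coprime_dvd_left htl hgcd)

/-- **Lemma 5.** Let `N = p₁^{α₁} ⋯ p_n^{α_n}` (distinct primes, each `α_i ≥ 1`).
If `D` is a maximal `N`-set, then `D = R(d(D), N)`: `D` consists exactly of the
positive divisors of `N` divisible by at least one divisible minimal element of `D`. -/
theorem stmt_12 (n : ℕ) (p α : Fin n → ℕ)
    (hp : ∀ i, (p i).Prime) (hinj : Function.Injective p)
    (hα : ∀ i, 1 ≤ α i)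
    (N : ℕ) (hN : N = ∏ i, p i ^ α i)
    (D : Finset ℕ) (hD : IsMaxNSet N D) :
    D = RSet (dSet D) N := by
  have hN0 : N ≠ 0 := by
    rw [hN]
    exact prod_ne_zero_iff.2 fun i _ => pow_ne_zero _ (hp i).ne_zero
  ext l
  simp only [RSet, mem_filter, Nat.mem_divisors]
  constructor
  · intro hl
    exact ⟨⟨hD.1.1 l hl, hN0⟩, exists_mem_dSet_dvd
      (fun d hd => Nat.pos_of_dvd_of_pos (hD.1.1 d hd) hN0.pos) hl⟩
  · rintro ⟨⟨hl, -⟩, t, ht, htl⟩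
    exact hD.mem_of_dvd (mem_filter.1 ht).1 htl hl
end
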